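/- arXiv:1801.10433 — 4 statements merged into one kernel-verified Lean document; each statement's English description precedes it below -/
import Mathlib

section
/- Let 𝕂 be ℝ or ℂ. Suppose A : Matrix (Fin M) (Fin N) 𝕂 satisfies the s-sparse RIP with constant δ_A, and B : Matrix (Fin m) (Fin n) 𝕂 satisfies the σ-sparse RIP with constant δ_B. Then for every (s,σ)-hierarchically sparse vector x : Fin N × Fin n → 𝕂 it holds that (1 − δ)·‖x‖² ≤ ‖(A ⊗ B).mulVec x‖² ≤ (1 + δ)·‖x‖², where δ = δ_A + δ_B + δ_A·δ_B. (Paper's Theorem 1: the Kronecker product of RIP matrices has the hierarchical RIP.) -/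
open scoped BigOperators

/-- Squared ℓ2 (Euclidean) norm of a vector. -/
def sqNorm {𝕂 : Type*} [RCLike 𝕂] {ι : Type*} [Fintype ι] (x : ι → 𝕂) : ℝ :=
  ∑ i, ‖x i‖ ^ 2

/-- `M` satisfies the `s`-sparse restricted isometry property with constant `δ ≥ 0`. -/
def SparseRIP {𝕂 : Type*} [RCLike 𝕂] {ι κ : Type*} [Fintype ι] [Fintype κ]
    (M : Matrix κ ι 𝕂) (s : ℕ) (δ : ℝ) : Prop :=
  0 ≤ δ ∧ ∀ x : ι → 𝕂, (Function.support x).ncard ≤ s →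
    (1 - δ) * sqNorm x ≤ sqNorm (M.mulVec x) ∧
      sqNorm (M.mulVec x) ≤ (1 + δ) * sqNorm x

/-- `x`, viewed as `N` blocks `x_i = x (i, ·)`, is `(s,σ)`-hierarchically sparse:
at most `s` blocks are nonzero and each block has at most `σ` nonzero entries. -/
def HiSparse {𝕂 : Type*} [RCLike 𝕂] {N n : ℕ} (x : Fin N × Fin n → 𝕂) (s σ : ℕ) : Prop :=
  (Function.support (fun i : Fin N => (fun j : Fin n => x (i, j)))).ncard ≤ s ∧
    ∀ i : Fin N, (Function.support (fun j : Fin n => x (i, j))).ncard ≤ σ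

theorem sqNorm_nonneg {𝕂 : Type*} [RCLike 𝕂] {ι : Type*} [Fintype ι] (x : ι → 𝕂) :
    0 ≤ sqNorm x :=
  Finset.sum_nonneg fun _ _ => sq_nonneg _

theorem sqNorm_prod {𝕂 : Type*} [RCLike 𝕂] {ι κ : Type*} [Fintype ι] [Fintype κ]
    (x : ι × κ → 𝕂) : sqNorm x = ∑ i, sqNorm fun j => x (i, j) :=
  Fintype.sum_prod_type _

theorem sqNorm_prod_right {𝕂 : Type*} [RCLike 𝕂] {ι κ : Type*} [Fintype ι] [Fintype κ]
    (x : ι × κ → 𝕂) : sqNorm x = ∑ j, sqNorm fun i => x (i, j) :=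
  Fintype.sum_prod_type_right _

theorem kroneckerMap_mul_mulVec_apply {R : Type*} [CommSemiring R] {ι κ ι' κ' : Type*}
    [Fintype ι] [Fintype κ] (A : Matrix ι' ι R) (B : Matrix κ' κ R) (x : ι × κ → R)
    (l : ι') (k : κ') :
    (Matrix.kroneckerMap (· * ·) A B).mulVec x (l, k) =
      A.mulVec (fun i => B.mulVec (fun j => x (i, j)) k) l := by
  simp only [Matrix.mulVec, dotProduct, Matrix.kroneckerMap_apply, Fintype.sum_prod_type,
    Finset.mul_sum, mul_assoc]

/-- The RIP bounds carry over to the total squared norm of a finite family of sparse vectors. -/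
theorem SparseRIP.sum {𝕂 : Type*} [RCLike 𝕂] {ι κ τ : Type*} [Fintype ι] [Fintype κ]
    [Fintype τ] {A : Matrix κ ι 𝕂} {s : ℕ} {δ : ℝ} (hA : SparseRIP A s δ) (y : τ → ι → 𝕂)
    (hy : ∀ t, (Function.support (y t)).ncard ≤ s) :
    (1 - δ) * ∑ t, sqNorm (y t) ≤ ∑ t, sqNorm (A.mulVec (y t)) ∧
      ∑ t, sqNorm (A.mulVec (y t)) ≤ (1 + δ) * ∑ t, sqNorm (y t) := by
  simp only [Finset.mul_sum]
  exact ⟨Finset.sum_le_sum fun t _ => (hA.2 (y t) (hy t)).1,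
    Finset.sum_le_sum fun t _ => (hA.2 (y t) (hy t)).2⟩

/-- **Theorem 1 (HiRIP of Kronecker products).**
If `A` has `s`-sparse RIP with constant `δA` and `B` has `σ`-sparse RIP with constant `δB`,
then `A ⊗ B` acts as a restricted isometry with constant
`δ = δA + δB + δA·δB` on all `(s,σ)`-hierarchically sparse vectors. -/
theorem kronecker_hiRIP {𝕂 : Type*} [RCLike 𝕂] {M N m n : ℕ}
    (A : Matrix (Fin M) (Fin N) 𝕂) (B : Matrix (Fin m) (Fin n) 𝕂)
    {s σ : ℕ} {δA δB : ℝ}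
    (hA : SparseRIP A s δA) (hB : SparseRIP B σ δB)
    (x : Fin N × Fin n → 𝕂) (hx : HiSparse x s σ) :
    (1 - (δA + δB + δA * δB)) * sqNorm x ≤
        sqNorm ((Matrix.kroneckerMap (· * ·) A B).mulVec x) ∧
      sqNorm ((Matrix.kroneckerMap (· * ·) A B).mulVec x) ≤
        (1 + (δA + δB + δA * δB)) * sqNorm x := by
  let y : Fin N × Fin m → 𝕂 := fun p => B.mulVec (fun j => x (p.1, j)) p.2
  have hy : ∀ k, (Function.support fun i => y (i, k)).ncard ≤ s := by
    refine fun k => (Set.ncard_le_ncard ?_ (Set.toFinite _)).trans hx.1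
    intro i hi hxi
    apply hi
    change B.mulVec (fun j => x (i, j)) k = 0
    have hxi' : (fun j => x (i, j)) = 0 := hxi
    rw [hxi', Matrix.mulVec_zero, Pi.zero_apply]
  obtain ⟨hBl, hBu⟩ := hB.sum (fun i j => x (i, j)) hx.2
  obtain ⟨hAl, hAu⟩ := hA.sum (fun k i => y (i, k)) hy
  rw [← sqNorm_prod x, ← sqNorm_prod y] at hBl hBu
  have hAy : sqNorm ((Matrix.kroneckerMap (· * ·) A B).mulVec x) =
      ∑ k, sqNorm (A.mulVec fun i => y (i, k)) := by
    simp only [sqNorm_prod_right, kroneckerMap_mul_mulVec_apply, y]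
  rw [← sqNorm_prod_right y, ← hAy] at hAl hAu
  have hδA := hA.1
  have hδB := hB.1
  have hx0 := sqNorm_nonneg x
  have hδ : 0 ≤ δA * δB * sqNorm x := by positivity
  constructor
  · rcases le_total δA 1 with h | h
    · have := mul_le_mul_of_nonneg_left hBl (sub_nonneg.2 h)
      linarith
    · refine le_trans (mul_nonpos_of_nonpos_of_nonneg ?_ hx0) (sqNorm_nonneg _)
      linarith [mul_nonneg hδA hδB]
  · have := mul_le_mul_of_nonneg_left hBu (by linarith : 0 ≤ 1 + δA)
    linarith
end

section
/- Let 𝕂 be ℝ or ℂ and let A : Matrix (Fin M) (Fin N) 𝕂 satisfy the s-sparse RIP with constant δ_A. Let ι be a finite type, B : Matrix (Fin m) ι 𝕂, δ_B ≥ 0, and let T be a set of vectors in ι → 𝕂 with 0 ∈ T such that (1−δ_B)·‖v‖² ≤ ‖B.mulVec v‖² ≤ (1+δ_B)·‖v‖² for all v ∈ T. Then every vector x : Fin N × ι → 𝕂 whose blocks x_i := x(i, ·) all lie in T and at most s of which are nonzero satisfies (1−δ)·‖x‖² ≤ ‖(A ⊗ B).mulVec x‖² ≤ (1+δ)·‖x‖²,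 where δ = δ_A + δ_B + δ_A·δ_B. (The inductive step underlying the paper's Theorem 2: a Kronecker factor with RIP combines with any restricted isometry on the blocks.) -/
open scoped BigOperators

theorem kroneckerMap_mulVec_apply {R ι κ ι' κ' : Type*} [CommSemiring R] [Fintype ι] [Fintype ι']
    (A : Matrix κ ι R) (B : Matrix κ' ι' R) (x : ι × ι' → R) (p : κ) (k : κ') :
    (Matrix.kroneckerMap (· * ·) A B).mulVec x (p, k) =
      A.mulVec (fun i => B.mulVec (fun j => x (i, j)) k) p := by
  simp only [Matrix.mulVec, dotProduct, Matrix.kroneckerMap_apply, Fintype.sum_prod_type,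
    Finset.mul_sum, mul_assoc]

theorem sqNorm_kroneckerMap_mulVec {𝕂 : Type*} [RCLike 𝕂] {ι κ ι' κ' : Type*}
    [Fintype ι] [Fintype κ] [Fintype ι'] [Fintype κ']
    (A : Matrix κ ι 𝕂) (B : Matrix κ' ι' 𝕂) (x : ι × ι' → 𝕂) :
    sqNorm ((Matrix.kroneckerMap (· * ·) A B).mulVec x) =
      ∑ k, sqNorm (A.mulVec fun i => B.mulVec (fun j => x (i, j)) k) := by
  simp only [sqNorm, Fintype.sum_prod_type_right, kroneckerMap_mulVec_apply]

/-- **Inductive step for multilevel HiRIP.** If `A` has `s`-sparse RIP with constant `δA`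
and `B` acts as a restricted isometry with constant `δB ≥ 0` on a set `T ∋ 0` of vectors,
then `A ⊗ B` acts as a restricted isometry with constant `δA + δB + δA·δB` on every vector
whose blocks all lie in `T` and at most `s` of which are nonzero. -/
theorem kronecker_restricted_isometry {𝕂 : Type*} [RCLike 𝕂] {M N m : ℕ}
    {ι : Type*} [Fintype ι]
    (A : Matrix (Fin M) (Fin N) 𝕂) {s : ℕ} {δA : ℝ} (hA : SparseRIP A s δA)
    (B : Matrix (Fin m) ι 𝕂) {δB : ℝ} (hδB : 0 ≤ δB)
    (T : Set (ι → 𝕂)) (hT0 : (0 : ι → 𝕂) ∈ T)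
    (hT : ∀ v ∈ T, (1 - δB) * sqNorm v ≤ sqNorm (B.mulVec v) ∧
      sqNorm (B.mulVec v) ≤ (1 + δB) * sqNorm v)
    (x : Fin N × ι → 𝕂)
    (hxT : ∀ i : Fin N, (fun j : ι => x (i, j)) ∈ T)
    (hxs : (Function.support (fun i : Fin N => (fun j : ι => x (i, j)))).ncard ≤ s) :
    (1 - (δA + δB + δA * δB)) * sqNorm x ≤
        sqNorm ((Matrix.kroneckerMap (· * ·) A B).mulVec x) ∧
      sqNorm ((Matrix.kroneckerMap (· * ·) A B).mulVec x) ≤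
        (1 + (δA + δB + δA * δB)) * sqNorm x := by
  obtain ⟨hδA, hA⟩ := hA
  have hsupp (k : Fin m) :
      (Function.support fun i => B.mulVec (fun j => x (i, j)) k).ncard ≤ s := by
    refine (Set.ncard_le_ncard (fun i hi => ?_) (Set.toFinite _)).trans hxs
    rw [Function.mem_support] at hi ⊢
    intro h
    exact hi (by rw [h, Matrix.mulVec_zero, Pi.zero_apply])
  have hswap : ∑ k, sqNorm (fun i => B.mulVec (fun j => x (i, j)) k) =
      ∑ i, sqNorm (B.mulVec fun j => x (i, j)) := Finset.sum_comm
  have hAlow := Finset.sum_le_sum fun k (_ : k ∈ Finset.univ) => (hA _ (hsupp k)).1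
  have hAup := Finset.sum_le_sum fun k (_ : k ∈ Finset.univ) => (hA _ (hsupp k)).2
  have hBlow := Finset.sum_le_sum fun i (_ : i ∈ Finset.univ) => (hT _ (hxT i)).1
  have hBup := Finset.sum_le_sum fun i (_ : i ∈ Finset.univ) => (hT _ (hxT i)).2
  rw [← Finset.mul_sum, hswap, ← sqNorm_kroneckerMap_mulVec] at hAlow hAup
  rw [← Finset.mul_sum, ← sqNorm_prod] at hBlow hBup
  have hx := sqNorm_nonneg x
  have hAB : 0 ≤ δA * δB := mul_nonneg hδA hδB
  constructor
  · rcases le_total δA 1 with h | h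
    · have := mul_le_mul_of_nonneg_left hBlow (sub_nonneg.2 h)
      linarith [mul_nonneg hAB hx]
    · refine le_trans ?_ (sqNorm_nonneg _)
      exact mul_nonpos_of_nonpos_of_nonneg (by linarith) hx
  · have := mul_le_mul_of_nonneg_left hBup (by linarith : 0 ≤ 1 + δA)
    linarith
end

section
/- Let 𝕂 be ℝ or ℂ, L ≥ 1, and let n, m, s : Fin L → ℕ. For each ℓ let A_ℓ : Matrix (Fin (m ℓ)) (Fin (n ℓ)) 𝕂 satisfy the (s ℓ)-sparse RIP with constant δ_ℓ. Then for every (s 0, …, s (L−1))-hierarchically sparse vector x : (Π ℓ : Fin L, Fin (n ℓ)) → 𝕂 it holds that (1−δ)·‖x‖² ≤ ‖(A_1 ⊗ ⋯ ⊗ A_L).mulVec x‖² ≤ (1+δ)·‖x‖², where δ = (∏_{ℓ} (1 + δ_ℓ)) − 1. (Paper's Theorem 2: multilevel hierarchical RIP of an L-fold Kronecker product.) -/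
open scoped BigOperators

/-- `x` is `(s 0, …, s (L−1))`-hierarchically sparse: for every level `ℓ` and every fixed
choice of the first `ℓ` indices (recorded in `p`), the number of indices `jℓ` such that the
restriction of `x` to multi-indices whose first `ℓ+1` components are `(p 0, …, p (ℓ-1), jℓ)`
is not identically zero is at most `s ℓ`. -/
def HiSparseML {𝕂 : Type*} [RCLike 𝕂] {L : ℕ} {n : Fin L → ℕ} (s : Fin L → ℕ)
    (x : ((k : Fin L) → Fin (n k)) → 𝕂) : Prop :=
  ∀ (ℓ : Fin L) (p : (k : Fin L) → Fin (n k)),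
    ({jℓ : Fin (n ℓ) | ∃ q : (k : Fin L) → Fin (n k),
      (∀ k : Fin L, k < ℓ → q k = p k) ∧ q ℓ = jℓ ∧ x q ≠ 0}).ncard ≤ s ℓ

/-- The `L`-fold Kronecker product `A 0 ⊗ ⋯ ⊗ A (L-1)`. -/
def kronL {𝕂 : Type*} [RCLike 𝕂] {L : ℕ} {m n : Fin L → ℕ}
    (A : (ℓ : Fin L) → Matrix (Fin (m ℓ)) (Fin (n ℓ)) 𝕂) :
    Matrix ((ℓ : Fin L) → Fin (m ℓ)) ((ℓ : Fin L) → Fin (n ℓ)) 𝕂 :=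
  fun r c => ∏ ℓ, A ℓ (r ℓ) (c ℓ)

/-- Summation over a dependent product splits off the first coordinate. -/
theorem sum_pi_eq_sum_cons {M : Type*} [AddCommMonoid M] {L : ℕ} {n : Fin (L + 1) → ℕ}
    (f : ((k : Fin (L + 1)) → Fin (n k)) → M) :
    ∑ q, f q = ∑ i : Fin (n 0), ∑ q : ((k : Fin L) → Fin (n k.succ)), f (Fin.cons i q) := by
  rw [← Fintype.sum_prod_type', ← (Fin.consEquiv fun k => Fin (n k)).sum_comp]
  rfl

theorem sqNorm_eq_sum_sqNorm_cons {𝕂 : Type*} [RCLike 𝕂] {L : ℕ} {n : Fin (L + 1) → ℕ}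
    (x : ((k : Fin (L + 1)) → Fin (n k)) → 𝕂) :
    sqNorm x = ∑ i : Fin (n 0), sqNorm fun q : (k : Fin L) → Fin (n k.succ) =>
      x (Fin.cons i q) :=
  sum_pi_eq_sum_cons _

/-- A Kronecker product is applied by first applying the product of the inner factors to each
block and then the outermost factor across the blocks. -/
theorem kronL_mulVec_cons {𝕂 : Type*} [RCLike 𝕂] {L : ℕ} {m n : Fin (L + 1) → ℕ}
    (A : (ℓ : Fin (L + 1)) → Matrix (Fin (m ℓ)) (Fin (n ℓ)) 𝕂)
    (x : ((k : Fin (L + 1)) → Fin (n k)) → 𝕂)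
    (r : Fin (m 0)) (t : (k : Fin L) → Fin (m k.succ)) :
    (kronL A).mulVec x (Fin.cons r t) =
      (A 0).mulVec (fun i =>
        (kronL fun k : Fin L => A k.succ).mulVec (fun q => x (Fin.cons i q)) t) r := by
  simp only [Matrix.mulVec, dotProduct, kronL]
  rw [sum_pi_eq_sum_cons]
  refine Finset.sum_congr rfl fun i _ => ?_
  rw [Finset.mul_sum]
  refine Finset.sum_congr rfl fun q _ => ?_
  rw [Fin.prod_univ_succ]
  simp only [Fin.cons_zero, Fin.cons_succ, mul_assoc]

/-- The blocks of a hierarchically sparse vector are hierarchically sparse. -/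
theorem HiSparseML.comp_cons {𝕂 : Type*} [RCLike 𝕂] {L : ℕ} {n s : Fin (L + 1) → ℕ}
    {x : ((k : Fin (L + 1)) → Fin (n k)) → 𝕂} (hx : HiSparseML s x) (i : Fin (n 0)) :
    HiSparseML (fun k : Fin L => s k.succ)
      (fun q : (k : Fin L) → Fin (n k.succ) => x (Fin.cons i q)) := by
  intro ℓ p
  refine (Set.ncard_le_ncard ?_ (Set.toFinite _)).trans (hx ℓ.succ (Fin.cons i p))
  rintro j ⟨q, hq, rfl, hne⟩
  refine ⟨Fin.cons i q, fun k => ?_, by simp, hne⟩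
  refine Fin.cases (fun _ => by simp) (fun k hk => ?_) k
  simpa using hq k (Fin.succ_lt_succ_iff.mp hk)

/-- A hierarchically sparse vector has at most `s 0` nonzero blocks. -/
theorem HiSparseML.ncard_cons_ne_zero_le {𝕂 : Type*} [RCLike 𝕂] {L : ℕ}
    {n s : Fin (L + 1) → ℕ} {x : ((k : Fin (L + 1)) → Fin (n k)) → 𝕂}
    (hx : HiSparseML s x) :
    {i : Fin (n 0) | ∃ q : (k : Fin L) → Fin (n k.succ), x (Fin.cons i q) ≠ 0}.ncard ≤ s 0 := by
  rcases Set.eq_empty_or_nonempty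
    {i : Fin (n 0) | ∃ q : (k : Fin L) → Fin (n k.succ), x (Fin.cons i q) ≠ 0} with h | h
  · simp [h]
  · obtain ⟨i₀, q₀, -⟩ := h
    refine (Set.ncard_le_ncard ?_ (Set.toFinite _)).trans (hx 0 (Fin.cons i₀ q₀))
    rintro i ⟨q, hq⟩
    exact ⟨Fin.cons i q, fun k hk => absurd hk (Fin.not_lt_zero k), by simp, hq⟩

/-- The restricted isometry bounds for Kronecker products with any number of factors. -/
theorem sqNorm_kronL_mulVec_bounds {𝕂 : Type*} [RCLike 𝕂] {L : ℕ} {m n s : Fin L → ℕ}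
    (A : (ℓ : Fin L) → Matrix (Fin (m ℓ)) (Fin (n ℓ)) 𝕂) (δ : Fin L → ℝ)
    (hA : ∀ ℓ : Fin L, SparseRIP (A ℓ) (s ℓ) (δ ℓ))
    (x : ((ℓ : Fin L) → Fin (n ℓ)) → 𝕂) (hx : HiSparseML s x) :
    (2 - ∏ ℓ : Fin L, (1 + δ ℓ)) * sqNorm x ≤ sqNorm ((kronL A).mulVec x) ∧
      sqNorm ((kronL A).mulVec x) ≤ (∏ ℓ : Fin L, (1 + δ ℓ)) * sqNorm x := by
  induction L with
  | zero =>
    have h : sqNorm ((kronL A).mulVec x) = sqNorm x := by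
      simp only [sqNorm, Matrix.mulVec, dotProduct, kronL, Fintype.sum_unique,
        Finset.univ_eq_empty, Finset.prod_empty, one_mul]
    rw [h, Finset.univ_eq_empty, Finset.prod_empty]
    constructor <;> linarith
  | succ L ih =>
    let B := kronL fun k : Fin L => A k.succ
    let y : Fin (n 0) → ((k : Fin L) → Fin (m k.succ)) → 𝕂 :=
      fun i => B.mulVec fun q => x (Fin.cons i q)
    have inner := fun i => ih (fun k => A k.succ) (fun k => δ k.succ) (fun k => hA k.succ)
      (fun q => x (Fin.cons i q)) (hx.comp_cons i)
    have outer : ∀ t, _ := fun t => (hA 0).2 (fun i => y i t) (by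
      refine (Set.ncard_le_ncard ?_ (Set.toFinite _)).trans hx.ncard_cons_ne_zero_le
      intro i hi
      by_contra hzero
      have hzero' : (fun q : (k : Fin L) → Fin (n k.succ) => x (Fin.cons i q)) = 0 := by
        funext q
        by_contra hq
        exact hzero ⟨q, hq⟩
      exact hi (by simp only [y, hzero', Matrix.mulVec_zero, Pi.zero_apply]))
    have hswap : ∑ t, sqNorm (fun i => y i t) = ∑ i, sqNorm (y i) := Finset.sum_comm
    have himage : sqNorm ((kronL A).mulVec x) =
        ∑ t, sqNorm ((A 0).mulVec fun i => y i t) := by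
      rw [sqNorm_eq_sum_sqNorm_cons]
      simp only [sqNorm, kronL_mulVec_cons]
      exact Finset.sum_comm
    have hinner_lower := Finset.sum_le_sum fun i (_ : i ∈ Finset.univ) => (inner i).1
    have hinner_upper := Finset.sum_le_sum fun i (_ : i ∈ Finset.univ) => (inner i).2
    have houter_lower := Finset.sum_le_sum fun t (_ : t ∈ Finset.univ) => (outer t).1
    have houter_upper := Finset.sum_le_sum fun t (_ : t ∈ Finset.univ) => (outer t).2
    rw [← Finset.mul_sum, ← sqNorm_eq_sum_sqNorm_cons] at hinner_lower hinner_upper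
    rw [← Finset.mul_sum, hswap, ← himage] at houter_lower houter_upper
    change _ ≤ ∑ i, sqNorm (y i) at hinner_lower
    change ∑ i, sqNorm (y i) ≤ _ at hinner_upper
    have hδ := (hA 0).1
    have hmul := mul_le_mul_of_nonneg_left hinner_upper hδ
    rw [Fin.prod_univ_succ]
    constructor <;> linarith

/-- **Theorem 2 (multilevel HiRIP of an L-fold Kronecker product).**
If each `A ℓ` has `(s ℓ)`-sparse RIP with constant `δ ℓ`, then the `L`-fold Kronecker
product acts as a restricted isometry with constant `(∏ ℓ, (1 + δ ℓ)) − 1` on all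
`(s 0, …, s (L−1))`-hierarchically sparse vectors. -/
theorem kronL_hiRIP {𝕂 : Type*} [RCLike 𝕂] {L : ℕ} (hL : 1 ≤ L)
    {m n s : Fin L → ℕ}
    (A : (ℓ : Fin L) → Matrix (Fin (m ℓ)) (Fin (n ℓ)) 𝕂) (δ : Fin L → ℝ)
    (hA : ∀ ℓ : Fin L, SparseRIP (A ℓ) (s ℓ) (δ ℓ))
    (x : ((ℓ : Fin L) → Fin (n ℓ)) → 𝕂) (hx : HiSparseML s x) :
    (1 - ((∏ ℓ : Fin L, (1 + δ ℓ)) - 1)) * sqNorm x ≤ sqNorm ((kronL A).mulVec x) ∧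
      sqNorm ((kronL A).mulVec x) ≤ (1 + ((∏ ℓ : Fin L, (1 + δ ℓ)) - 1)) * sqNorm x := by
  have h := sqNorm_kronL_mulVec_bounds A δ hA x hx
  constructor <;> linarith [h.1, h.2]
end

section
/- Let 𝕂 be ℝ or ℂ and let B : Matrix (Fin m) (Fin n) 𝕂 satisfy the s-sparse RIP with constant δ_s. Then for every L ≥ 1 and every (s, …, s)-hierarchically sparse (with L levels, sparsity s on each level) vector x : (Fin L → Fin n) → 𝕂 it holds that (1−δ)·‖x‖² ≤ ‖(B^{⊗L}).mulVec x‖² ≤ (1+δ)·‖x‖², where δ = (1 + δ_s)^L − 1 and B^{⊗L} is the L-fold Kronecker power of B. (Paper's Corollary 2: HiRIP of Kronecker powers, enabling efficiently checkable HiRIP.) -/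
open scoped BigOperators

/-- `x` is `(s, …, s)`-hierarchically sparse with `L` levels: for every level `ℓ` and every
fixed choice of the first `ℓ` indices (recorded in `p`), the number of indices `jℓ` such that
the restriction of `x` to multi-indices whose first `ℓ+1` components are
`(p 0, …, p (ℓ-1), jℓ)` is not identically zero is at most `s`. -/
def HiSparseUniform {𝕂 : Type*} [RCLike 𝕂] {L n : ℕ} (s : ℕ)
    (x : (Fin L → Fin n) → 𝕂) : Prop :=
  ∀ (ℓ : Fin L) (p : Fin L → Fin n),
    ({jℓ : Fin n | ∃ q : Fin L → Fin n,
      (∀ k : Fin L, k < ℓ → q k = p k) ∧ q ℓ = jℓ ∧ x q ≠ 0}).ncard ≤ s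

/-- The `L`-fold Kronecker power `B^{⊗L}`. -/
def kronPow {𝕂 : Type*} [RCLike 𝕂] {m n : ℕ} (B : Matrix (Fin m) (Fin n) 𝕂) (L : ℕ) :
    Matrix (Fin L → Fin m) (Fin L → Fin n) 𝕂 :=
  fun r c => ∏ ℓ : Fin L, B (r ℓ) (c ℓ)

theorem sqNorm_fin_cons {𝕂 : Type*} [RCLike 𝕂] {L n : ℕ} (x : (Fin (L + 1) → Fin n) → 𝕂) :
    sqNorm x = ∑ j, sqNorm fun q => x (Fin.cons j q) := by
  unfold sqNorm
  rw [← (Fin.consEquiv fun _ => Fin n).sum_comp, Fintype.sum_prod_type]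
  rfl

theorem kronPow_succ_mulVec {𝕂 : Type*} [RCLike 𝕂] {m n : ℕ} (B : Matrix (Fin m) (Fin n) 𝕂)
    {L : ℕ} (x : (Fin (L + 1) → Fin n) → 𝕂) (i : Fin m) (r : Fin L → Fin m) :
    (kronPow B (L + 1)).mulVec x (Fin.cons i r) =
      B.mulVec (fun j => (kronPow B L).mulVec (fun q => x (Fin.cons j q)) r) i := by
  simp only [Matrix.mulVec, dotProduct, kronPow, Finset.mul_sum]
  rw [← (Fin.consEquiv fun _ => Fin n).sum_comp, Fintype.sum_prod_type]
  simp [Fin.consEquiv, Fin.prod_univ_succ, mul_assoc]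

theorem HiSparseUniform.cons {𝕂 : Type*} [RCLike 𝕂] {L n s : ℕ}
    {x : (Fin (L + 1) → Fin n) → 𝕂} (hx : HiSparseUniform s x) (j : Fin n) :
    HiSparseUniform s fun q : Fin L → Fin n => x (Fin.cons j q) := by
  intro ℓ p
  refine (Set.ncard_le_ncard ?_ (Set.toFinite _)).trans (hx ℓ.succ (Fin.cons j p))
  rintro _ ⟨q, hq, rfl, hne⟩
  refine ⟨Fin.cons j q, fun k hk => ?_, by simp, hne⟩
  cases k using Fin.cases with
  | zero => simp
  | succ k => simpa using hq k (by simpa using hk)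

theorem HiSparseUniform.ncard_support_mulVec_le {𝕂 κ : Type*} [RCLike 𝕂] {L n s : ℕ}
    {x : (Fin (L + 1) → Fin n) → 𝕂} (hx : HiSparseUniform s x)
    (A : Matrix κ (Fin L → Fin n) 𝕂) (r : κ) :
    (Function.support fun j => A.mulVec (fun q => x (Fin.cons j q)) r).ncard ≤ s := by
  rcases isEmpty_or_nonempty (Fin n) with hn | ⟨⟨i⟩⟩
  · simp [Set.eq_empty_of_isEmpty]
  refine (Set.ncard_le_ncard ?_ (Set.toFinite _)).trans (hx 0 fun _ => i)
  intro j hj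
  obtain ⟨q, -, hq⟩ := Finset.exists_ne_zero_of_sum_ne_zero hj
  exact ⟨Fin.cons j q, fun k hk => absurd hk (Fin.not_lt_zero k), rfl, right_ne_zero_of_mul hq⟩

theorem SparseRIP.kronPow_bounds {𝕂 : Type*} [RCLike 𝕂] {m n : ℕ}
    {B : Matrix (Fin m) (Fin n) 𝕂} {s : ℕ} {δ : ℝ} (hB : SparseRIP B s δ) (L : ℕ)
    (x : (Fin L → Fin n) → 𝕂) (hx : HiSparseUniform s x) :
    (1 - ((1 + δ) ^ L - 1)) * sqNorm x ≤ sqNorm ((kronPow B L).mulVec x) ∧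
      sqNorm ((kronPow B L).mulVec x) ≤ (1 + ((1 + δ) ^ L - 1)) * sqNorm x := by
  induction L with
  | zero =>
    simp [sqNorm, kronPow, Matrix.mulVec, dotProduct,
      Subsingleton.elim _ (default : Fin 0 → Fin n)]
  | succ L ih =>
    obtain ⟨hδ, hB⟩ := hB
    let z : Fin n → (Fin L → Fin m) → 𝕂 := fun j =>
      (kronPow B L).mulVec fun q => x (Fin.cons j q)
    have hz : ∑ r, sqNorm (fun j => z j r) = ∑ j, sqNorm (z j) := Finset.sum_comm
    have hBz : sqNorm ((kronPow B (L + 1)).mulVec x) =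
        ∑ r, sqNorm (B.mulVec fun j => z j r) := by
      rw [sqNorm_fin_cons]
      simp only [sqNorm, kronPow_succ_mulVec]
      exact Finset.sum_comm
    have hstep r := hB (fun j => z j r) (hx.ncard_support_mulVec_le (kronPow B L) r)
    have hlower := Finset.sum_le_sum fun r (_ : r ∈ Finset.univ) => (hstep r).1
    have hupper := Finset.sum_le_sum fun r (_ : r ∈ Finset.univ) => (hstep r).2
    have ihlower := Finset.sum_le_sum fun j (_ : j ∈ Finset.univ) => (ih _ (hx.cons j)).1
    have ihupper := Finset.sum_le_sum fun j (_ : j ∈ Finset.univ) => (ih _ (hx.cons j)).2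
    rw [← Finset.mul_sum, hz, ← hBz] at hlower hupper
    rw [← Finset.mul_sum, ← sqNorm_fin_cons] at ihlower ihupper
    change _ ≤ ∑ j, sqNorm (z j) at ihlower
    change ∑ j, sqNorm (z j) ≤ _ at ihupper
    have hmul := mul_le_mul_of_nonneg_left ihupper hδ
    rw [pow_succ]
    constructor <;> linarith

/-- **Corollary 2 (HiRIP of Kronecker powers).**
If `B` has `s`-sparse RIP with constant `δs`, then `B^{⊗L}` acts as a restricted isometry
with constant `(1 + δs)^L − 1` on all `(s, …, s)`-hierarchically sparse vectors. -/
theorem kronPow_hiRIP {𝕂 : Type*} [RCLike 𝕂] {m n : ℕ}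
    (B : Matrix (Fin m) (Fin n) 𝕂) {s : ℕ} {δs : ℝ} (hB : SparseRIP B s δs)
    (L : ℕ) (hL : 1 ≤ L)
    (x : (Fin L → Fin n) → 𝕂) (hx : HiSparseUniform s x) :
    (1 - ((1 + δs) ^ L - 1)) * sqNorm x ≤ sqNorm ((kronPow B L).mulVec x) ∧
      sqNorm ((kronPow B L).mulVec x) ≤ (1 + ((1 + δs) ^ L - 1)) * sqNorm x :=
  hB.kronPow_bounds L x hx
end
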